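/- Let q be an odd prime power, 1 ≤ d < m ≤ q, and let f ∈ F_q[x] be non-constant with deg f ≥ 2, not a square over the algebraic closure, and f(0) ≠ 0. Then the number N of d-f-Diophantine m-tuples (i.e., m-element subsets {a_1,…,a_m} ⊆ F_q such that f(∏_{k} a_{i_k}) is a square in F_q for every choice of d distinct indices) satisfies N = q^m / (m! · 2^{binom(m,d)}) + O(q^{m-1/2}), where the implied constant depends on deg f, m, d. -/

import Mathlib

open Polynomial

theorem pow_sub_dvd_hasseDeriv_pow {R : Type*} [CommRing R] (f : R[X]) (n i : ℕ) :
    f ^ (n - i) ∣ hasseDeriv i (f ^ n) := by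
  induction n generalizing i with
  | zero => simp
  | succ n ih =>
    rw [pow_succ, hasseDeriv_mul]
    refine Finset.dvd_sum fun uv huv => ?_
    rw [Finset.HasAntidiagonal.mem_antidiagonal] at huv
    rcases Nat.eq_zero_or_pos uv.2 with h | h
    · rw [h, hasseDeriv_zero']
      exact (pow_dvd_pow f (show n + 1 - i ≤ (n - uv.1) + 1 by omega)).trans
        (by rw [pow_succ]; exact mul_dvd_mul_right (ih _) _)
    · exact ((pow_dvd_pow f (by omega)).trans (ih uv.1)).mul_right _

/-- The `k`-th Hasse derivative of `f ^ n * r` is `f ^ (n - k)` times a polynomial which depends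
linearly on `r` and whose degree exceeds that of `r` by at most `k * deg f`. -/
theorem exists_linearMap_hasseDeriv_pow_mul {F : Type*} [Field F] {f : F[X]} (hf : f ≠ 0)
    {e : ℕ} (he : f.natDegree ≤ e) {n k : ℕ} (hk : k ≤ n) :
    ∃ Q : F[X] →ₗ[F] F[X], (∀ r, hasseDeriv k (f ^ n * r) = f ^ (n - k) * Q r) ∧
      ∀ B r, r ∈ degreeLT F B → Q r ∈ degreeLT F (B + k * e) := by
  choose G hG using pow_sub_dvd_hasseDeriv_pow f n
  let Q : F[X] →ₗ[F] F[X] := ∑ ij ∈ Finset.HasAntidiagonal.antidiagonal k,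
    LinearMap.mulLeft F (f ^ (k - ij.1) * G ij.1) ∘ₗ hasseDeriv ij.2
  have hQ : ∀ r, hasseDeriv k (f ^ n * r) = f ^ (n - k) * Q r := by
    intro r
    rw [hasseDeriv_mul, LinearMap.sum_apply, Finset.mul_sum]
    refine Finset.sum_congr rfl fun ij hij => ?_
    rw [Finset.HasAntidiagonal.mem_antidiagonal] at hij
    rw [hG, LinearMap.comp_apply, LinearMap.mulLeft_apply,
      show n - ij.1 = (n - k) + (k - ij.1) by omega, pow_add]
    ring
  refine ⟨Q, hQ, fun B r hr => ?_⟩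
  by_cases h0 : Q r = 0
  · rw [h0]; exact Submodule.zero_mem _
  have hr0 : r ≠ 0 := by rintro rfl; exact h0 (map_zero _)
  rw [mem_degreeLT, ← natDegree_lt_iff_degree_lt hr0] at hr
  rw [mem_degreeLT, ← natDegree_lt_iff_degree_lt h0]
  have h1 := natDegree_hasseDeriv_le (f ^ n * r) k
  rw [hQ, natDegree_mul (pow_ne_zero _ hf) h0, natDegree_mul (pow_ne_zero _ hf) hr0,
    natDegree_pow, natDegree_pow] at h1
  have h2 : n * f.natDegree = (n - k) * f.natDegree + k * f.natDegree := by
    rw [← add_mul]; congr 1; omega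
  have h3 : k * f.natDegree ≤ k * e := Nat.mul_le_mul_left _ he
  omega

/-- If `f` is not a square over an algebraic closure, then `r ^ 2 * f` is not a constant times a
square unless `r = 0`. -/
theorem eq_zero_of_sq_mul_eq_C_mul_sq {F : Type*} [Field F] {f : F[X]}
    (hf : ¬ ∃ g : (AlgebraicClosure F)[X], f.map (algebraMap F (AlgebraicClosure F)) = g ^ 2)
    {c : F} {r s : F[X]} (h : r ^ 2 * f = C c * s ^ 2) : r = 0 := by
  by_contra hr
  apply hf
  obtain ⟨z, hz⟩ := IsAlgClosed.exists_pow_nat_eq (algebraMap F (AlgebraicClosure F) c)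
    (show 0 < 2 by norm_num)
  have h' := congrArg (Polynomial.map (algebraMap F (AlgebraicClosure F))) h
  simp only [Polynomial.map_mul, Polynomial.map_pow, map_C, ← hz] at h'
  have hr' : r.map (algebraMap F (AlgebraicClosure F)) ≠ 0 := by
    rwa [Ne, Polynomial.map_eq_zero]
  have hd : r.map (algebraMap F (AlgebraicClosure F)) ^ 2 ∣
      (C z * s.map (algebraMap F (AlgebraicClosure F))) ^ 2 :=
    ⟨_, by rw [h', C_pow]; ring⟩
  rw [UniqueFactorizationMonoid.pow_dvd_pow_iff_dvd two_ne_zero] at hd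
  obtain ⟨t, ht⟩ := hd
  refine ⟨t, mul_left_cancel₀ (pow_ne_zero 2 hr') ?_⟩
  rw [h', C_pow, ← mul_pow, ht]
  ring

/-- The linear independence at the heart of Stepanov's method. -/
theorem stepanov_independence {F : Type*} [Field F] [Fintype F] {f : F[X]}
    (hodd : Odd (Fintype.card F)) (hf0 : f.eval 0 ≠ 0)
    (hf : ¬ ∃ g : (AlgebraicClosure F)[X], f.map (algebraMap F (AlgebraicClosure F)) = g ^ 2)
    {B : ℕ} (hB : 2 * B + f.natDegree ≤ Fintype.card F) (J : ℕ) (r s : Fin J → F[X])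
    (hr : ∀ j, r j ∈ degreeLT F B) (hs : ∀ j, s j ∈ degreeLT F B)
    (h : ∑ j : Fin J, (r j + s j * f ^ (Fintype.card F / 2)) *
      X ^ ((j : ℕ) * Fintype.card F) = 0) :
    r = 0 ∧ s = 0 := by
  induction J with
  | zero => exact ⟨Subsingleton.elim _ _, Subsingleton.elim _ _⟩
  | succ J ih =>
    set q := Fintype.card F with hq
    have hq0 : 0 < q := Fintype.card_pos
    set g := f ^ (q / 2) with hg
    have hgf : g ^ 2 * f = expand F q f := by
      rw [FiniteField.expand_card, hg, ← pow_mul, ← pow_succ]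
      congr 1
      obtain ⟨t, ht⟩ := hodd
      omega
    rw [Fin.sum_univ_succ] at h
    set T := ∑ j : Fin J, (r j.succ + s j.succ * g) * X ^ ((j : ℕ) * q) with hT
    have hsum : ∑ j : Fin J, (r j.succ + s j.succ * g) * X ^ (((j.succ : Fin (J + 1)) : ℕ) * q)
        = X ^ q * T := by
      rw [hT, Finset.mul_sum]
      refine Finset.sum_congr rfl fun j _ => ?_
      rw [Fin.val_succ, Nat.succ_mul, pow_add]
      ring
    rw [hsum] at h
    simp only [Fin.val_zero, zero_mul, pow_zero, mul_one] at h
    have hexp : (X : F[X]) ^ q ∣ expand F q f - C (f.eval 0) := by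
      have : X ∣ f - C (f.eval 0) := by
        rw [X_dvd_iff, coeff_sub, coeff_C_zero, coeff_zero_eq_eval_zero, sub_self]
      obtain ⟨u, hu⟩ := this
      refine ⟨expand F q u, ?_⟩
      have := congrArg (expand F q) hu
      rwa [map_sub, map_mul, expand_X, expand_C] at this
    have hdvd : (X : F[X]) ^ q ∣ r 0 ^ 2 * f - C (f.eval 0) * s 0 ^ 2 := by
      obtain ⟨u, hu⟩ := hexp
      refine ⟨-T * (r 0 - s 0 * g) * f + s 0 ^ 2 * u, ?_⟩
      have h1 : r 0 + s 0 * g = - (X ^ q * T) := by linear_combination h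
      linear_combination (r 0 - s 0 * g) * f * h1 + s 0 ^ 2 * hgf + s 0 ^ 2 * hu
    have hdeg : ∀ {p : F[X]}, p ∈ degreeLT F B → p.natDegree < B ∨ p = 0 := by
      intro p hp
      by_cases h0 : p = 0
      · exact Or.inr h0
      · left; rwa [mem_degreeLT, ← natDegree_lt_iff_degree_lt h0] at hp
    have hkey : r 0 ^ 2 * f - C (f.eval 0) * s 0 ^ 2 = 0 := by
      refine eq_zero_of_dvd_of_natDegree_lt hdvd ?_
      rw [natDegree_X_pow]
      refine lt_of_le_of_lt (natDegree_sub_le _ _) (max_lt ?_ ?_)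
      · rcases hdeg (hr 0) with h1 | h1
        · have := natDegree_mul_le (p := r 0 ^ 2) (q := f)
          have := natDegree_pow_le (p := r 0) (n := 2)
          omega
        · simpa [h1] using hq0
      · rcases hdeg (hs 0) with h1 | h1
        · have := natDegree_C_mul_le (f.eval 0) (s 0 ^ 2)
          have := natDegree_pow_le (p := s 0) (n := 2)
          omega
        · simpa [h1] using hq0
    have hr0 : r 0 = 0 := eq_zero_of_sq_mul_eq_C_mul_sq hf (sub_eq_zero.mp hkey)
    have hs0 : s 0 = 0 := by
      rw [hr0] at hkey
      simpa [hf0] using hkey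
    rw [hr0, hs0, zero_mul, add_zero, zero_add] at h
    have hT0 : T = 0 := (mul_eq_zero.mp h).resolve_left (pow_ne_zero _ X_ne_zero)
    obtain ⟨h1, h2⟩ := ih (fun j => r j.succ) (fun j => s j.succ) (fun j => hr _)
      (fun j => hs _) hT0
    constructor
    · funext j
      refine Fin.cases hr0 (fun i => congrFun h1 i) j
    · funext j
      refine Fin.cases hs0 (fun i => congrFun h2 i) j

theorem finrank_degreeLT_eq (F : Type*) [Field F] (n : ℕ) :
    Module.finrank F (degreeLT F n) = n := by
  rw [(degreeLTEquiv F n).finrank_eq, Module.finrank_fin_fun]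

instance finiteDimensional_degreeLT (F : Type*) [Field F] (n : ℕ) :
    FiniteDimensional F (degreeLT F n) :=
  Module.Finite.equiv (degreeLTEquiv F n).symm

/-- The coefficients of Stepanov's auxiliary polynomial. -/
theorem stepanov_exists_coeffs {F : Type*} [Field F] {f : F[X]} (hf : f ≠ 0) {e : ℕ}
    (he : f.natDegree ≤ e) (a : F) (c ℓ B J : ℕ) (hcount : ℓ * (B + J + ℓ * e) < 2 * J * B) :
    ∃ r s : Fin J → F[X], (∀ j, r j ∈ degreeLT F B) ∧ (∀ j, s j ∈ degreeLT F B) ∧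
      ¬ (r = 0 ∧ s = 0) ∧ ∀ x : F, f.eval x = 0 ∨ f.eval x ^ c = a → ∀ k < ℓ,
        (hasseDeriv k (∑ j : Fin J, f ^ ℓ * (r j + s j * f ^ c) * C (x ^ (j : ℕ)))).eval x = 0 := by
  have hQ := fun k : Fin ℓ => exists_linearMap_hasseDeriv_pow_mul hf he k.2.le
  have hQ' := fun k : Fin ℓ => exists_linearMap_hasseDeriv_pow_mul hf he
    (show (k : ℕ) ≤ ℓ + c by have := k.2; omega)
  choose Q hQ hQd using hQ
  choose Q' hQ' hQd' using hQ'
  let V := (Fin J → degreeLT F B) × (Fin J → degreeLT F B)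
  let L : Fin ℓ → V →ₗ[F] F[X] := fun k => ∑ j : Fin J,
    LinearMap.mulRight F (X ^ (j : ℕ)) ∘ₗ
      (Q k ∘ₗ (degreeLT F B).subtype ∘ₗ LinearMap.proj j ∘ₗ LinearMap.fst F _ _ +
        a • (Q' k ∘ₗ (degreeLT F B).subtype ∘ₗ LinearMap.proj j ∘ₗ LinearMap.snd F _ _))
  have hL : ∀ k v, L k v = ∑ j : Fin J, (Q k (v.1 j) + a • Q' k (v.2 j)) * X ^ (j : ℕ) := by
    intro k v
    simp [L, LinearMap.sum_apply]
    rfl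
  have hLmem : ∀ k v, L k v ∈ degreeLT F (B + J + ℓ * e) := by
    intro k v
    rw [hL]
    refine Submodule.sum_mem _ fun j _ => ?_
    have h1 : Q k (v.1 j) + a • Q' k (v.2 j) ∈ degreeLT F (B + k * e) :=
      Submodule.add_mem _ (hQd k B _ (v.1 j).2) (Submodule.smul_mem _ _ (hQd' k B _ (v.2 j).2))
    set u := Q k (v.1 j) + a • Q' k (v.2 j)
    by_cases hu : u = 0
    · rw [hu, zero_mul]; exact Submodule.zero_mem _
    rw [mem_degreeLT, ← natDegree_lt_iff_degree_lt hu] at h1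
    rw [mem_degreeLT, ← natDegree_lt_iff_degree_lt (mul_ne_zero hu (pow_ne_zero _ X_ne_zero)),
      natDegree_mul hu (pow_ne_zero _ X_ne_zero), natDegree_X_pow]
    have h2 : (k : ℕ) * e ≤ ℓ * e := Nat.mul_le_mul_right _ k.2.le
    have := j.2
    omega
  let Φ : V →ₗ[F] Fin ℓ → degreeLT F (B + J + ℓ * e) :=
    LinearMap.pi fun k => (L k).codRestrict _ (hLmem k)
  have hker : LinearMap.ker Φ ≠ ⊥ := by
    apply LinearMap.ker_ne_bot_of_finrank_lt
    rw [Module.finrank_pi_fintype, Module.finrank_prod, Module.finrank_pi_fintype]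
    simp only [finrank_degreeLT_eq, Finset.sum_const, Finset.card_univ, Fintype.card_fin,
      smul_eq_mul]
    linarith
  obtain ⟨v, hv, hv0⟩ := Submodule.exists_mem_ne_zero_of_ne_bot hker
  refine ⟨fun j => v.1 j, fun j => v.2 j, fun j => (v.1 j).2, fun j => (v.2 j).2, ?_, ?_⟩
  · rintro ⟨h1, h2⟩
    apply hv0
    refine Prod.ext (funext fun j => Subtype.ext (congrFun h1 j))
      (funext fun j => Subtype.ext (congrFun h2 j))
  · intro x hx k hk
    have hLk : L ⟨k, hk⟩ v = 0 := by
      have := congrFun (LinearMap.mem_ker.mp hv) ⟨k, hk⟩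
      exact congrArg Subtype.val this
    have hterm : ∀ j : Fin J,
        (hasseDeriv k (f ^ ℓ * ((v.1 j : F[X]) + (v.2 j : F[X]) * f ^ c) * C (x ^ (j : ℕ)))).eval x =
          f.eval x ^ (ℓ - k) *
            ((Q ⟨k, hk⟩ (v.1 j) + a • Q' ⟨k, hk⟩ (v.2 j)) * X ^ (j : ℕ)).eval x := by
      intro j
      have h1 : f ^ ℓ * ((v.1 j : F[X]) + (v.2 j : F[X]) * f ^ c) * C (x ^ (j : ℕ)) =
          (x ^ (j : ℕ)) • (f ^ ℓ * (v.1 j : F[X]) + f ^ (ℓ + c) * (v.2 j : F[X])) := by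
        rw [smul_eq_C_mul, pow_add]; ring
      have h2 : ℓ + c - k = (ℓ - k) + c := by omega
      have h3 : f.eval x ^ (ℓ - k) * f.eval x ^ c = f.eval x ^ (ℓ - k) * a := by
        rcases hx with hx | hx
        · rw [hx, zero_pow (by omega), zero_mul, zero_mul]
        · rw [hx]
      rw [h1, map_smul, map_add, hQ ⟨k, hk⟩, hQ' ⟨k, hk⟩]
      simp only [eval_smul, eval_add, eval_mul, eval_pow, eval_X, smul_eq_mul, h2, pow_add]
      linear_combination x ^ (j : ℕ) * eval x (Q' ⟨k, hk⟩ (v.2 j)) * h3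
    rw [map_sum, eval_finsetSum, Finset.sum_congr rfl fun j _ => hterm j, ← Finset.mul_sum,
      ← eval_finsetSum, ← hL, hLk, eval_zero, mul_zero]

theorem stepanov_card_le {F : Type*} [Field F] [Fintype F] {f : F[X]}
    (hodd : Odd (Fintype.card F)) (hf0 : f.eval 0 ≠ 0)
    (hf : ¬ ∃ g : (AlgebraicClosure F)[X], f.map (algebraMap F (AlgebraicClosure F)) = g ^ 2)
    {e : ℕ} (he : f.natDegree ≤ e) (a : F) {ℓ B J : ℕ}
    (hcount : ℓ * (B + J + ℓ * e) < 2 * J * B) (hB : 2 * B + e ≤ Fintype.card F)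
    (hℓ : ℓ ≤ Fintype.card F) (S : Finset F)
    (hS : ∀ x ∈ S, f.eval x = 0 ∨ f.eval x ^ (Fintype.card F / 2) = a) :
    ℓ * S.card ≤ ℓ * e + B + Fintype.card F / 2 * e + J * Fintype.card F := by
  have hfne : f ≠ 0 := by rintro rfl; simp at hf0
  set q := Fintype.card F with hq
  set c := q / 2 with hc
  obtain ⟨r, s, hr, hs, hne, hv⟩ := stepanov_exists_coeffs hfne he a c ℓ B J hcount
  set T := ∑ j : Fin J, (r j + s j * f ^ c) * X ^ ((j : ℕ) * q) with hT
  have hT0 : T ≠ 0 := fun h => hne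
    (stepanov_independence hodd hf0 hf (by omega) J r s hr hs h)
  have hP0 : f ^ ℓ * T ≠ 0 := mul_ne_zero (pow_ne_zero _ hfne) hT0
  have hdvd : ∀ x ∈ S, (X - C x) ^ ℓ ∣ f ^ ℓ * T := by
    intro x hx
    have h1 : (X - C x) ^ ℓ ∣ ∑ j : Fin J, f ^ ℓ * (r j + s j * f ^ c) * C (x ^ (j : ℕ)) := by
      rw [X_sub_C_pow_dvd_iff, ← taylor_apply, X_pow_dvd_iff]
      intro k hk
      rw [taylor_coeff]
      exact hv x (hS x hx) k hk
    have h2 : (X - C x) ^ ℓ ∣ X ^ q - C x := by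
      refine (pow_dvd_pow _ hℓ).trans (dvd_of_eq ?_)
      obtain ⟨p, hp⟩ := CharP.exists F
      obtain ⟨n, hpp, hn⟩ := FiniteField.card F p
      have := Fact.mk hpp
      have h3 : x ^ q = x := FiniteField.pow_card x
      rw [hq, hn, sub_pow_char_pow, ← C_pow, ← hn, ← hq, h3]
    have h3 : f ^ ℓ * T - ∑ j : Fin J, f ^ ℓ * (r j + s j * f ^ c) * C (x ^ (j : ℕ)) =
        ∑ j : Fin J, f ^ ℓ * (r j + s j * f ^ c) * ((X ^ q) ^ (j : ℕ) - (C x) ^ (j : ℕ)) := by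
      rw [hT, Finset.mul_sum, ← Finset.sum_sub_distrib]
      refine Finset.sum_congr rfl fun j _ => ?_
      rw [C_pow, mul_comm (j : ℕ) q, pow_mul]
      ring
    refine (dvd_iff_dvd_of_dvd_sub (?_ : _ ∣ _ - _)).mpr h1
    rw [h3]
    exact Finset.dvd_sum fun j _ => (h2.trans (sub_dvd_pow_sub_pow _ _ _)).mul_left _
  have hprod : ∏ x ∈ S, (X - C x) ^ ℓ ∣ f ^ ℓ * T := by
    refine Finset.prod_dvd_of_coprime (fun x _ y _ hxy => ?_) hdvd
    exact (pairwise_coprime_X_sub_C Function.injective_id hxy).pow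
  have hdeg := natDegree_le_of_dvd hprod hP0
  rw [natDegree_prod_of_monic _ _ fun x _ => (monic_X_sub_C x).pow ℓ] at hdeg
  simp only [natDegree_pow, natDegree_X_sub_C, mul_one, Finset.sum_const, smul_eq_mul] at hdeg
  have hmemle : ∀ {p : F[X]}, p ∈ degreeLT F B → p.natDegree ≤ B := by
    intro p hp
    exact natDegree_le_of_degree_le (mem_degreeLT.mp hp).le
  have hce : c * f.natDegree ≤ c * e := Nat.mul_le_mul_left _ he
  have hTdeg : T.natDegree ≤ B + c * e + J * q := by
    refine natDegree_sum_le_of_forall_le _ _ fun j _ => ?_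
    have h1 : (r j + s j * f ^ c).natDegree ≤ B + c * e := by
      refine (natDegree_add_le _ _).trans (max_le ((hmemle (hr j)).trans (by omega)) ?_)
      have h4 := hmemle (hs j)
      have h5 := natDegree_mul_le (p := s j) (q := f ^ c)
      rw [natDegree_pow] at h5
      omega
    have h2 := natDegree_mul_le (p := r j + s j * f ^ c) (q := X ^ ((j : ℕ) * q))
    rw [natDegree_X_pow] at h2
    have h3 : (j : ℕ) * q ≤ J * q := Nat.mul_le_mul_right _ j.2.le
    omega
  have hle : ℓ * f.natDegree ≤ ℓ * e := Nat.mul_le_mul_left _ he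
  have hmul := natDegree_mul_le (p := f ^ ℓ) (q := T)
  rw [natDegree_pow] at hmul
  rw [mul_comm]
  omega

theorem two_mul_stepanov_card_le {F : Type*} [Field F] [Fintype F] {f : F[X]}
    (hodd : Odd (Fintype.card F)) (hf0 : f.eval 0 ≠ 0)
    (hf : ¬ ∃ g : (AlgebraicClosure F)[X], f.map (algebraMap F (AlgebraicClosure F)) = g ^ 2)
    {e : ℕ} (he : f.natDegree ≤ e) (hlarge : 4 * e + 7 ≤ Nat.sqrt (Fintype.card F))
    (a : F) (S : Finset F)
    (hS : ∀ x ∈ S, f.eval x = 0 ∨ f.eval x ^ (Fintype.card F / 2) = a) :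
    2 * S.card ≤ Fintype.card F + (22 * e + 32) * Nat.sqrt (Fintype.card F) := by
  set q := Fintype.card F with hq
  obtain ⟨ℓ, hℓ⟩ : ∃ ℓ, ℓ = Nat.sqrt q := ⟨_, rfl⟩
  rw [← hℓ] at hlarge ⊢
  have h1 : ℓ * ℓ ≤ q := hℓ ▸ Nat.sqrt_le q
  have h2 : q < (ℓ + 1) * (ℓ + 1) := hℓ ▸ Nat.lt_succ_sqrt q
  obtain ⟨B, hB⟩ : ∃ B, B = (q - e) / 2 := ⟨_, rfl⟩
  obtain ⟨J, hJ⟩ : ∃ J, J = (ℓ + (4 * e + 5)) / 2 + 1 := ⟨_, rfl⟩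
  have hℓq : 7 * ℓ ≤ q := by nlinarith
  have hB1 : 2 * B + e ≤ q := by omega
  have hB2 : q ≤ 4 * B := by omega
  have hJ1 : ℓ + (4 * e + 5) ≤ 2 * J := by omega
  have hJ2 : 2 * J ≤ ℓ + (4 * e + 7) := by omega
  have hJ3 : J ≤ ℓ := by omega
  have hcount : ℓ * (B + J + ℓ * e) < 2 * J * B := by
    have h3 : ℓ * J ≤ ℓ * ℓ := Nat.mul_le_mul_left _ hJ3
    have h4 : (ℓ + (4 * e + 5)) * B ≤ 2 * J * B := Nat.mul_le_mul_right _ hJ1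
    have h5 : ℓ * ℓ * (e + 1) ≤ 4 * B * (e + 1) := Nat.mul_le_mul_right _ (h1.trans hB2)
    have h6 : 0 < B := by omega
    nlinarith
  have key := stepanov_card_le hodd hf0 hf he a hcount hB1 (by omega) S hS
  rw [← hq] at key
  have h7 : q / 2 * e * 2 ≤ q * e := by
    have := Nat.mul_le_mul_right e (Nat.div_mul_le_self q 2)
    linarith
  have h8 : 2 * J * q ≤ (ℓ + (4 * e + 7)) * q := Nat.mul_le_mul_right _ hJ2
  have h9 : q ≤ 4 * (ℓ * ℓ) := by nlinarith
  have h10 : q * (5 * e + 8) ≤ 4 * (ℓ * ℓ) * (5 * e + 8) := Nat.mul_le_mul_right _ h9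
  have h11 : ℓ * (2 * S.card) ≤ ℓ * (q + (22 * e + 32) * ℓ) := by nlinarith
  exact Nat.le_of_mul_le_mul_left h11 (by omega)

/-- A form of Weil's bound for quadratic character sums. -/
theorem abs_sum_quadraticChar_eval_le {F : Type*} [Field F] [Fintype F] [DecidableEq F] {f : F[X]}
    (hodd : Odd (Fintype.card F)) (hf0 : f.eval 0 ≠ 0)
    (hf : ¬ ∃ g : (AlgebraicClosure F)[X], f.map (algebraMap F (AlgebraicClosure F)) = g ^ 2)
    {e : ℕ} (he : f.natDegree ≤ e) :
    |∑ x : F, quadraticChar F (f.eval x)| ≤ (22 * e + 32) * Nat.sqrt (Fintype.card F) := by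
  have hchar : ringChar F ≠ 2 := by
    rw [Ne, FiniteField.even_card_iff_char_two]
    obtain ⟨t, ht⟩ := hodd
    omega
  by_cases hlarge : 4 * e + 7 ≤ Nat.sqrt (Fintype.card F)
  · let S : F → Finset F := fun a =>
      Finset.univ.filter fun x => f.eval x = 0 ∨ f.eval x ^ (Fintype.card F / 2) = a
    have hS := fun a => two_mul_stepanov_card_le hodd hf0 hf he hlarge a (S a)
      (fun x hx => (Finset.mem_filter.mp hx).2)
    have hne : (1 : F) ≠ -1 := (Ring.neg_one_ne_one_of_char_ne_two hchar).symm
    have hdich : ∀ y : F, y ≠ 0 → y ^ (Fintype.card F / 2) = 1 ∨ y ^ (Fintype.card F / 2) = -1 :=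
      fun y hy => FiniteField.pow_dichotomy hchar hy
    have hcard : ∀ a, ((S a).card : ℤ) =
        ∑ x : F, if f.eval x = 0 ∨ f.eval x ^ (Fintype.card F / 2) = a then 1 else 0 := by
      intro a
      rw [Finset.sum_boole]
    have hdiff : ∑ x : F, quadraticChar F (f.eval x) = (S 1).card - (S (-1)).card := by
      rw [hcard, hcard, ← Finset.sum_sub_distrib]
      refine Finset.sum_congr rfl fun x _ => ?_
      by_cases h0 : f.eval x = 0
      · simp [h0]
      · rw [quadraticChar_eq_pow_of_char_ne_two hchar h0]
        rcases hdich _ h0 with h | h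
        · simp [h, h0, hne]
        · simp [h, h0, hne.symm]
    have hsum : (Fintype.card F : ℤ) ≤ (S 1).card + (S (-1)).card := by
      rw [hcard, hcard, ← Finset.sum_add_distrib, Fintype.card_eq_sum_ones, Nat.cast_sum]
      refine Finset.sum_le_sum fun x _ => ?_
      by_cases h0 : f.eval x = 0
      · simp [h0]
      · rcases hdich _ h0 with h | h
        · simp [h, h0, hne]
        · simp [h, h0, hne.symm]
    have h1 : (2 * ((S 1).card) : ℤ) ≤
        Fintype.card F + (22 * e + 32) * Nat.sqrt (Fintype.card F) := by exact_mod_cast hS 1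
    have h2 : (2 * ((S (-1)).card) : ℤ) ≤
        Fintype.card F + (22 * e + 32) * Nat.sqrt (Fintype.card F) := by exact_mod_cast hS (-1)
    rw [hdiff, abs_le]
    constructor <;> linarith
  · have h1 : |∑ x : F, quadraticChar F (f.eval x)| ≤ ∑ _x : F, (1 : ℤ) :=
      (Finset.abs_sum_le_sum_abs _ _).trans (Finset.sum_le_sum fun x _ => by
        rcases quadraticChar_isQuadratic F (f.eval x) with h | h | h <;> simp [h])
    rw [Finset.sum_const, Finset.card_univ, nsmul_eq_mul, mul_one] at h1
    refine h1.trans ?_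
    obtain ⟨ℓ, hℓ⟩ : ∃ ℓ, ℓ = Nat.sqrt (Fintype.card F) := ⟨_, rfl⟩
    have h2 : Fintype.card F < (ℓ + 1) * (ℓ + 1) := hℓ ▸ Nat.lt_succ_sqrt _
    rw [← hℓ] at hlarge ⊢
    have h3 : Fintype.card F ≤ (22 * e + 32) * ℓ := by nlinarith
    exact_mod_cast h3

theorem card_mul_sum_eq_sum_sum_update {ι F M : Type*} [Fintype ι] [DecidableEq ι] [Fintype F]
    [CommSemiring M] (φ : (ι → F) → M) (i : ι) :
    (Fintype.card F : M) * ∑ a, φ a = ∑ a, ∑ x, φ (Function.update a i x) := by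
  classical
  have h : ∑ p : (ι → F) × F, φ (Function.update p.1 i p.2) = ∑ p : (ι → F) × F, φ p.1 :=
    Finset.sum_nbij' (fun p => (Function.update p.1 i p.2, p.1 i))
      (fun p => (Function.update p.1 i p.2, p.1 i)) (by simp) (by simp) (by simp) (by simp)
      (by simp)
  rw [Fintype.sum_prod_type, Fintype.sum_prod_type] at h
  rw [h, Finset.mul_sum]
  simp

/-- If `P` has at most `c` solutions on every line in direction `i`, it has at most
`c * |F| ^ (|ι| - 1)` solutions. -/
theorem card_filter_le_of_forall_update {ι F : Type*} [Fintype ι] [DecidableEq ι] [Fintype F]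
    [DecidableEq F] [Nonempty F] (P : (ι → F) → Prop) [DecidablePred P] (i : ι) (c : ℕ)
    (h : ∀ a, (Finset.univ.filter fun x => P (Function.update a i x)).card ≤ c) :
    (Finset.univ.filter P).card ≤ c * Fintype.card F ^ (Fintype.card ι - 1) := by
  have h1 := card_mul_sum_eq_sum_sum_update (fun a => if P a then 1 else 0 : (ι → F) → ℕ) i
  simp only [Finset.sum_boole, Nat.cast_id] at h1
  have h2 := Finset.sum_le_sum fun a (_ : a ∈ (Finset.univ : Finset (ι → F))) => h a
  rw [← h1, Finset.sum_const, Finset.card_univ, Fintype.card_fun, smul_eq_mul] at h2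
  obtain ⟨n, hn⟩ : ∃ n, Fintype.card ι = n + 1 :=
    Nat.exists_eq_succ_of_ne_zero (Fintype.card_pos_iff.mpr ⟨i⟩).ne'
  rw [hn, pow_succ] at h2
  rw [hn, Nat.add_sub_cancel]
  refine Nat.le_of_mul_le_mul_left (h2.trans_eq ?_) (Fintype.card_pos (α := F))
  ring

theorem not_exists_sq_prod_comp {F ι : Type*} [Field F] [DecidableEq ι] {f : F[X]}
    (hf : ¬ ∃ g : (AlgebraicClosure F)[X], f.map (algebraMap F (AlgebraicClosure F)) = g ^ 2)
    (s : Finset ι) (hs : s.Nonempty) (b : ι → F) (hb : ∀ i ∈ s, b i ≠ 0)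
    (hroots : ∀ i ∈ s, ∀ j ∈ s, i ≠ j → ∀ α β : AlgebraicClosure F,
      aeval α f = 0 → aeval β f = 0 →
        algebraMap F (AlgebraicClosure F) (b i) * β ≠ algebraMap F (AlgebraicClosure F) (b j) * α) :
    ¬ ∃ g : (AlgebraicClosure F)[X],
      (∏ i ∈ s, f.comp (C (b i) * X)).map (algebraMap F (AlgebraicClosure F)) = g ^ 2 := by
  rintro ⟨g, hg⟩
  obtain ⟨i, hi⟩ := hs
  rw [← Finset.mul_prod_erase s _ hi, Polynomial.map_mul] at hg
  have hcop : IsCoprime (f.comp (C (b i) * X)) (∏ j ∈ s.erase i, f.comp (C (b j) * X)) := by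
    refine IsCoprime.prod_right fun j hj => ?_
    rw [Finset.mem_erase] at hj
    rw [isCoprime_iff_aeval_ne_zero_of_isAlgClosed F (AlgebraicClosure F)]
    intro x
    by_contra hcon
    push Not at hcon
    simp only [aeval_comp, map_mul, aeval_C, aeval_X] at hcon
    exact hroots i hi j hj.2 hj.1.symm _ _ hcon.1 hcon.2 (by ring)
  have hcop' := hcop.map (mapRingHom (algebraMap F (AlgebraicClosure F)))
  simp only [coe_mapRingHom] at hcop'
  obtain ⟨d, u, hd⟩ := exists_associated_pow_of_mul_eq_pow' hcop' hg
  obtain ⟨v, hv, hvu⟩ := Polynomial.isUnit_iff.mp u.isUnit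
  obtain ⟨z, hz⟩ := IsAlgClosed.exists_pow_nat_eq v (show 0 < 2 by norm_num)
  apply hf
  set b' := algebraMap F (AlgebraicClosure F) (b i) with hb'
  have hb0 : b' ≠ 0 := by
    rw [hb', Ne, map_eq_zero]
    exact hb i hi
  refine ⟨(d * C z).comp (C b'⁻¹ * X), ?_⟩
  have h1 : (d * C z) ^ 2 =
      (f.map (algebraMap F (AlgebraicClosure F))).comp (C b' * X) := by
    rw [mul_pow, ← C_pow, hz, hvu, hd, Polynomial.map_comp]
    simp [hb']
  have h2 : (C b' * X : (AlgebraicClosure F)[X]).comp (C b'⁻¹ * X) = X := by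
    rw [mul_comp, C_comp, X_comp, ← mul_assoc, ← C_mul, mul_inv_cancel₀ hb0, C_1, one_mul]
  rw [← pow_comp, h1, comp_assoc, h2, comp_X]

/-- Tuples with a zero coordinate, or for which two of the products over members of `𝒯` differ by
a ratio of roots of `f`. -/
def Degenerate {F ι : Type*} [Field F] (f : F[X]) (𝒯 : Finset (Finset ι)) (a : ι → F) : Prop :=
  (∃ i, a i = 0) ∨ ∃ T ∈ 𝒯, ∃ T' ∈ 𝒯, T ≠ T' ∧ ∃ α β : AlgebraicClosure F,
    aeval α f = 0 ∧ aeval β f = 0 ∧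
      algebraMap F (AlgebraicClosure F) (∏ i ∈ T, a i) * β =
        algebraMap F (AlgebraicClosure F) (∏ i ∈ T', a i) * α

theorem card_degenerate_le {F ι : Type*} [Field F] [Fintype F] [DecidableEq F] [Fintype ι]
    [DecidableEq ι] {f : F[X]} (hf0 : f.eval 0 ≠ 0) {d : ℕ} {𝒯 : Finset (Finset ι)}
    (h𝒯 : ∀ T ∈ 𝒯, T.card = d) [DecidablePred (Degenerate f 𝒯)] :
    (Finset.univ.filter (Degenerate f 𝒯)).card ≤
      (Fintype.card ι + 𝒯.card ^ 2 * f.natDegree ^ 2) *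
        Fintype.card F ^ (Fintype.card ι - 1) := by
  have hfne : f ≠ 0 := by rintro rfl; simp at hf0
  classical
  set R' := (f.aroots (AlgebraicClosure F)).toFinset with hR'
  have hR'card : R'.card ≤ f.natDegree := by
    refine (Multiset.toFinset_card_le _).trans ((card_roots' _).trans ?_)
    rw [natDegree_map]
  have hmem : ∀ α, α ∈ R' ↔ aeval α f = 0 := by
    intro α
    rw [hR', Multiset.mem_toFinset, mem_aroots]
    exact ⟨fun h => h.2, fun h => ⟨hfne, h⟩⟩
  have hne0 : ∀ α : AlgebraicClosure F, aeval α f = 0 → α ≠ 0 := by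
    rintro α hα rfl
    apply hf0
    rw [← coeff_zero_eq_aeval_zero', map_eq_zero] at hα
    rwa [← coeff_zero_eq_eval_zero]
  let Z : ι → Finset (ι → F) := fun i => Finset.univ.filter fun a => a i = 0
  let Y : (Finset ι × Finset ι) × (AlgebraicClosure F × AlgebraicClosure F) → Finset (ι → F) :=
    fun p => Finset.univ.filter fun a => (∀ i, a i ≠ 0) ∧
      algebraMap F (AlgebraicClosure F) (∏ i ∈ p.1.1, a i) * p.2.2 =
        algebraMap F (AlgebraicClosure F) (∏ i ∈ p.1.2, a i) * p.2.1
  have hZ : ∀ i, (Z i).card ≤ 1 * Fintype.card F ^ (Fintype.card ι - 1) := by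
    intro i
    refine card_filter_le_of_forall_update _ i 1 fun a => ?_
    rw [Finset.card_le_one]
    intro x hx y hy
    simp only [Finset.mem_filter, Function.update_self] at hx hy
    rw [hx.2, hy.2]
  have hY : ∀ p ∈ ((𝒯 ×ˢ 𝒯).filter fun t => t.1 ≠ t.2) ×ˢ (R' ×ˢ R'),
      (Y p).card ≤ 1 * Fintype.card F ^ (Fintype.card ι - 1) := by
    rintro ⟨⟨T, T'⟩, α, β⟩ hp
    simp only [Finset.mem_product, Finset.mem_filter, hmem] at hp
    obtain ⟨⟨⟨hT, hT'⟩, hTT'⟩, hα, hβ⟩ := hp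
    have hcard := (h𝒯 T hT).trans (h𝒯 T' hT').symm
    have hns : ¬ T ⊆ T' := fun h => hTT' (Finset.eq_of_subset_of_card_le h (by omega))
    obtain ⟨i, hi, hi'⟩ := Finset.not_subset.mp hns
    refine card_filter_le_of_forall_update _ i 1 fun a => ?_
    rw [Finset.card_le_one]
    intro x hx y hy
    simp only [Finset.mem_filter, Finset.mem_univ, true_and, Finset.prod_update_of_mem hi,
      Finset.prod_update_of_notMem hi', map_mul] at hx hy
    have hc : ∏ j ∈ T \ {i}, a j ≠ 0 := by
      refine Finset.prod_ne_zero_iff.mpr fun j hj => ?_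
      rw [Finset.mem_sdiff, Finset.mem_singleton] at hj
      have := hx.1 j
      rwa [Function.update_of_ne hj.2] at this
    have hxy := hx.2.trans hy.2.symm
    have hc' : algebraMap F (AlgebraicClosure F) (∏ j ∈ T \ {i}, a j) ≠ 0 := by
      rwa [Ne, map_eq_zero]
    have := mul_right_cancel₀ hc' (mul_right_cancel₀ (hne0 β hβ) hxy)
    exact (algebraMap F (AlgebraicClosure F)).injective this
  have hsub : Finset.univ.filter (Degenerate f 𝒯) ⊆ Finset.univ.biUnion Z ∪
      (((𝒯 ×ˢ 𝒯).filter fun t => t.1 ≠ t.2) ×ˢ (R' ×ˢ R')).biUnion Y := by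
    intro a ha
    have hdeg := (Finset.mem_filter.mp ha).2
    rw [Finset.mem_union]
    by_cases h0 : ∃ i, a i = 0
    · left
      obtain ⟨i, hi⟩ := h0
      exact Finset.mem_biUnion.mpr ⟨i, Finset.mem_univ _, by simp [Z, hi]⟩
    · right
      obtain ⟨T, hT, T', hT', hTT', α, β, hα, hβ, h⟩ := hdeg.resolve_left h0
      push Not at h0
      refine Finset.mem_biUnion.mpr ⟨((T, T'), (α, β)), ?_, ?_⟩
      · simp only [Finset.mem_product, Finset.mem_filter, hmem]
        exact ⟨⟨⟨hT, hT'⟩, hTT'⟩, hα, hβ⟩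
      · simp only [Y, Finset.mem_filter, Finset.mem_univ, true_and]
        exact ⟨h0, h⟩
  refine (Finset.card_le_card hsub).trans ((Finset.card_union_le _ _).trans ?_)
  rw [add_mul]
  refine add_le_add ?_ ?_
  · refine (Finset.card_biUnion_le_card_mul _ _ _ fun i _ => hZ i).trans ?_
    rw [Finset.card_univ, one_mul]
  · refine (Finset.card_biUnion_le_card_mul _ _ _ hY).trans ?_
    rw [one_mul]
    refine Nat.mul_le_mul_right _ ?_
    rw [Finset.card_product, Finset.card_product]
    have h1 : ((𝒯 ×ˢ 𝒯).filter fun t => t.1 ≠ t.2).card ≤ 𝒯.card ^ 2 := by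
      refine (Finset.card_filter_le _ _).trans_eq ?_
      rw [Finset.card_product, sq]
    refine Nat.mul_le_mul h1 ?_
    rw [sq]
    exact Nat.mul_le_mul hR'card hR'card

theorem abs_quadraticChar_le_one {F : Type*} [Field F] [Fintype F] [DecidableEq F] (y : F) :
    |quadraticChar F y| ≤ 1 := by
  rcases quadraticChar_isQuadratic F y with h | h | h <;> simp [h]

theorem abs_sum_update_le_of_not_degenerate {F ι : Type*} [Field F] [Fintype F] [DecidableEq F]
    [DecidableEq ι] {f : F[X]} (hodd : Odd (Fintype.card F)) (hf0 : f.eval 0 ≠ 0)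
    (hf : ¬ ∃ g : (AlgebraicClosure F)[X], f.map (algebraMap F (AlgebraicClosure F)) = g ^ 2)
    {𝒯 J : Finset (Finset ι)} (hJ : J ⊆ 𝒯) {T₀ : Finset ι} (hT₀ : T₀ ∈ J) {k : ι} (hk : k ∈ T₀)
    {a : ι → F} (ha : ¬ Degenerate f 𝒯 a) :
    |∑ x : F, quadraticChar F (∏ T ∈ J, f.eval (∏ i ∈ T, Function.update a k x i))| ≤
      (22 * (𝒯.card * f.natDegree : ℕ) + 32) * Nat.sqrt (Fintype.card F) := by
  unfold Degenerate at ha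
  push Not at ha
  obtain ⟨ha0, hab⟩ := ha
  set J' := J.filter (k ∈ ·) with hJ'
  set g : F[X] := ∏ T ∈ J', f.comp (C (∏ i ∈ T \ {k}, a i) * X) with hg
  set u : F := ∏ T ∈ J.filter (k ∉ ·), f.eval (∏ i ∈ T, a i) with hu
  have hfac : ∀ x : F, ∏ T ∈ J, f.eval (∏ i ∈ T, Function.update a k x i) = g.eval x * u := by
    intro x
    rw [← Finset.prod_filter_mul_prod_filter_not J (k ∈ ·), hg, eval_prod, hu]
    congr 1
    · refine Finset.prod_congr rfl fun T hT => ?_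
      rw [Finset.prod_update_of_mem (Finset.mem_filter.mp hT).2, eval_comp, eval_mul, eval_C,
        eval_X, mul_comm]
    · refine Finset.prod_congr rfl fun T hT => ?_
      rw [Finset.prod_update_of_notMem (Finset.mem_filter.mp hT).2]
  have hsplit : ∀ T ∈ J', ∏ i ∈ T, a i = a k * ∏ i ∈ T \ {k}, a i := by
    intro T hT
    rw [← Finset.prod_update_of_mem (Finset.mem_filter.mp hT).2, Function.update_eq_self]
  have hgns : ¬ ∃ h : (AlgebraicClosure F)[X],
      g.map (algebraMap F (AlgebraicClosure F)) = h ^ 2 := by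
    refine not_exists_sq_prod_comp hf J' ⟨T₀, Finset.mem_filter.mpr ⟨hT₀, hk⟩⟩ _
      (fun T _ => Finset.prod_ne_zero_iff.mpr fun i _ => ha0 i) ?_
    intro T hT T' hT' hTT' α β hα hβ h
    refine hab T (hJ (Finset.mem_filter.mp hT).1) T' (hJ (Finset.mem_filter.mp hT').1) hTT'
      α β hα hβ ?_
    rw [hsplit T hT, hsplit T' hT', map_mul, map_mul, mul_assoc, mul_assoc, h]
  have hg0 : g.eval 0 ≠ 0 := by
    rw [hg, eval_prod]
    refine Finset.prod_ne_zero_iff.mpr fun T _ => ?_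
    simpa [eval_comp] using hf0
  have hgdeg : g.natDegree ≤ 𝒯.card * f.natDegree := by
    refine (natDegree_prod_le _ _).trans ((Finset.sum_le_card_nsmul _ _ f.natDegree ?_).trans ?_)
    · intro T _
      refine natDegree_comp_le.trans ?_
      refine (Nat.mul_le_mul_left _ ((natDegree_C_mul_le _ _).trans_eq natDegree_X)).trans_eq
        (mul_one _)
    · rw [smul_eq_mul]
      exact Nat.mul_le_mul_right _
        (Finset.card_le_card ((Finset.filter_subset _ _).trans hJ))
  simp only [hfac, map_mul]
  rw [← Finset.sum_mul, abs_mul]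
  refine (mul_le_of_le_one_right (abs_nonneg _) (abs_quadraticChar_le_one u)).trans ?_
  exact abs_sum_quadraticChar_eval_le hodd hg0 hgns hgdeg

theorem abs_sum_quadraticChar_prod_le {F ι : Type*} [Field F] [Fintype F] [DecidableEq F]
    [Fintype ι] [DecidableEq ι] {f : F[X]} (hodd : Odd (Fintype.card F)) (hf0 : f.eval 0 ≠ 0)
    (hf : ¬ ∃ g : (AlgebraicClosure F)[X], f.map (algebraMap F (AlgebraicClosure F)) = g ^ 2)
    {d : ℕ} (hd : 1 ≤ d) {𝒯 J : Finset (Finset ι)} (h𝒯 : ∀ T ∈ 𝒯, T.card = d) (hJ : J ⊆ 𝒯)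
    (hne : J.Nonempty) :
    |∑ a : ι → F, quadraticChar F (∏ T ∈ J, f.eval (∏ i ∈ T, a i))| ≤
      Fintype.card F ^ (Fintype.card ι - 1) *
        (((22 * (𝒯.card * f.natDegree) + 32) * Nat.sqrt (Fintype.card F)) +
          (Fintype.card ι + 𝒯.card ^ 2 * f.natDegree ^ 2) : ℕ) := by
  classical
  obtain ⟨T₀, hT₀⟩ := hne
  have hT₀card := h𝒯 _ (hJ hT₀)
  obtain ⟨k, hk⟩ : T₀.Nonempty := by
    rw [← Finset.card_pos]
    omega
  set q := Fintype.card F with hq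
  set W : ℕ := (22 * (𝒯.card * f.natDegree) + 32) * Nat.sqrt q with hW
  set φ : (ι → F) → ℤ := fun a => quadraticChar F (∏ T ∈ J, f.eval (∏ i ∈ T, a i)) with hφ
  have hline : ∀ a : ι → F, |∑ x : F, φ (Function.update a k x)| ≤
      (W : ℤ) + if Degenerate f 𝒯 a then (q : ℤ) else 0 := by
    intro a
    by_cases ha : Degenerate f 𝒯 a
    · rw [if_pos ha]
      have h1 : |∑ x : F, φ (Function.update a k x)| ≤ ∑ _x : F, (1 : ℤ) :=
        (Finset.abs_sum_le_sum_abs _ _).trans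
          (Finset.sum_le_sum fun x _ => abs_quadraticChar_le_one _)
      rw [Finset.sum_const, Finset.card_univ, nsmul_eq_mul, mul_one] at h1
      have : (0 : ℤ) ≤ W := Int.natCast_nonneg _
      linarith
    · rw [if_neg ha, add_zero]
      refine (abs_sum_update_le_of_not_degenerate hodd hf0 hf hJ hT₀ hk ha).trans_eq ?_
      rw [hW]
      push_cast
      rfl
  have hbad := card_degenerate_le hf0 h𝒯
  rw [← hq] at hbad
  have hsum := card_mul_sum_eq_sum_sum_update φ k
  have h1 : (q : ℤ) * |∑ a, φ a| ≤
      ∑ a : ι → F, ((W : ℤ) + if Degenerate f 𝒯 a then (q : ℤ) else 0) := by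
    rw [← abs_of_nonneg (Int.natCast_nonneg q), ← abs_mul, hsum,
      abs_of_nonneg (Int.natCast_nonneg q)]
    exact (Finset.abs_sum_le_sum_abs _ _).trans (Finset.sum_le_sum fun a _ => hline a)
  obtain ⟨n, hn⟩ : ∃ n, Fintype.card ι = n + 1 :=
    Nat.exists_eq_succ_of_ne_zero (Fintype.card_pos_iff.mpr ⟨k⟩).ne'
  rw [Finset.sum_add_distrib, Finset.sum_const, Finset.card_univ, Fintype.card_fun,
    ← Finset.sum_filter, Finset.sum_const, nsmul_eq_mul, nsmul_eq_mul] at h1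
  have hqpos : (0 : ℤ) < q := by exact_mod_cast Fintype.card_pos (α := F)
  have hbad' : ((Finset.univ.filter (Degenerate f 𝒯)).card : ℤ) ≤
      ((Fintype.card ι + 𝒯.card ^ 2 * f.natDegree ^ 2 : ℕ) : ℤ) *
        (q : ℤ) ^ (Fintype.card ι - 1) := by exact_mod_cast hbad
  refine le_of_mul_le_mul_left (h1.trans ?_) hqpos
  rw [← hq]
  have h2 : (q ^ Fintype.card ι : ℕ) = (q : ℤ) * (q : ℤ) ^ (Fintype.card ι - 1) := by
    rw [hn, Nat.add_sub_cancel, ← pow_succ']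
    push_cast
    rfl
  rw [h2, Nat.cast_add W]
  nlinarith [mul_le_mul_of_nonneg_right hbad' hqpos.le]

theorem card_filter_injective_image {F ι : Type*} [Fintype F] [DecidableEq F] [Fintype ι]
    [DecidableEq ι] (P : Finset F → Prop) [DecidablePred P]
    [DecidablePred (Function.Injective : (ι → F) → Prop)] :
    (Finset.univ.filter fun a : ι → F => Function.Injective a ∧ P (Finset.univ.image a)).card =
      (Fintype.card ι).factorial *
        (Finset.univ.filter fun S : Finset F => S.card = Fintype.card ι ∧ P S).card := by
  rw [Finset.card_eq_sum_card_fiberwise (f := fun a : ι → F => Finset.univ.image a)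
    (t := Finset.univ.filter fun S : Finset F => S.card = Fintype.card ι ∧ P S), mul_comm,
    ← smul_eq_mul]
  · refine Finset.sum_const_nat (fun S hS => ?_)
    rw [Finset.mem_filter] at hS
    obtain ⟨-, hcard, hP⟩ := hS
    have hequiv : Fintype.card (ι ≃ S) = (Fintype.card ι).factorial :=
      Fintype.card_equiv (Fintype.equivOfCardEq (by rw [Fintype.card_coe, hcard]))
    rw [← hequiv, ← Finset.card_univ]
    have himage : ∀ e : ι ≃ S, Finset.univ.image (fun i => (e i : F)) = S := by
      intro e
      ext x
      simp only [Finset.mem_image, Finset.mem_univ, true_and]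
      exact ⟨fun ⟨i, hi⟩ => hi ▸ (e i).2, fun hx => ⟨e.symm ⟨x, hx⟩, by simp⟩⟩
    symm
    refine Finset.card_bij (fun e _ i => (e i : F)) ?_ ?_ ?_
    · intro e _
      simp only [Finset.mem_filter, Finset.mem_univ, true_and, himage, hP, and_true]
      exact Subtype.val_injective.comp e.injective
    · intro e _ e' _ h
      exact Equiv.ext fun i => Subtype.ext (congrFun h i)
    · intro a ha
      simp only [Finset.mem_filter, Finset.mem_univ, true_and] at ha
      obtain ⟨⟨hinj, -⟩, himg⟩ := ha
      have hmem : ∀ i, a i ∈ S := fun i => himg ▸ Finset.mem_image_of_mem a (Finset.mem_univ i)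
      refine ⟨Equiv.ofBijective (fun i => ⟨a i, hmem i⟩) ⟨?_, ?_⟩, Finset.mem_univ _, rfl⟩
      · intro i j hij
        exact hinj (congrArg Subtype.val hij)
      · rintro ⟨x, hx⟩
        rw [← himg] at hx
        obtain ⟨i, -, hi⟩ := Finset.mem_image.mp hx
        exact ⟨i, Subtype.ext hi⟩
  · intro a ha
    simp only [Finset.coe_filter, Finset.mem_univ, true_and, Set.mem_ofPred_eq] at ha ⊢
    exact ⟨by rw [Finset.card_image_of_injective _ ha.1, Finset.card_univ], ha.2⟩

theorem card_not_injective_or_eval_eq_zero_le {F ι : Type*} [Field F] [Fintype F] [DecidableEq F]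
    [Fintype ι] [DecidableEq ι] {f : F[X]} (hf0 : f.eval 0 ≠ 0) {d : ℕ} (hd : 1 ≤ d)
    {𝒯 : Finset (Finset ι)} (h𝒯 : ∀ T ∈ 𝒯, T.card = d)
    [DecidablePred fun a : ι → F => ¬ Function.Injective a ∨
      ∃ T ∈ 𝒯, f.eval (∏ i ∈ T, a i) = 0] :
    (Finset.univ.filter fun a : ι → F => ¬ Function.Injective a ∨
      ∃ T ∈ 𝒯, f.eval (∏ i ∈ T, a i) = 0).card ≤
      (Fintype.card ι ^ 2 + 𝒯.card * f.natDegree) *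
        Fintype.card F ^ (Fintype.card ι - 1) := by
  let Y : ι × ι → Finset (ι → F) := fun p => Finset.univ.filter fun a => a p.1 = a p.2
  let Z : Finset ι → Finset (ι → F) := fun T =>
    Finset.univ.filter fun a => f.eval (∏ i ∈ T, a i) = 0
  have hY : ∀ p ∈ (Finset.univ : Finset (ι × ι)).filter fun p => p.1 ≠ p.2,
      (Y p).card ≤ 1 * Fintype.card F ^ (Fintype.card ι - 1) := by
    rintro ⟨i, j⟩ hij
    have hij' : j ≠ i := (Finset.mem_filter.mp hij).2.symm
    refine card_filter_le_of_forall_update _ i 1 fun a => ?_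
    rw [Finset.card_le_one]
    intro x hx y hy
    simp only [Finset.mem_filter, Function.update_self, Function.update_of_ne hij'] at hx hy
    rw [hx.2, hy.2]
  have hZ : ∀ T ∈ 𝒯, (Z T).card ≤ f.natDegree * Fintype.card F ^ (Fintype.card ι - 1) := by
    intro T hT
    obtain ⟨k, hk⟩ : T.Nonempty := by
      rw [← Finset.card_pos, h𝒯 T hT]
      exact hd
    refine card_filter_le_of_forall_update _ k _ fun a => ?_
    set g : F[X] := f.comp (C (∏ i ∈ T \ {k}, a i) * X) with hg
    have hg0 : g ≠ 0 := by
      intro h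
      apply hf0
      have := congrArg (eval 0) h
      simpa [hg, eval_comp] using this
    have hdeg : g.natDegree ≤ f.natDegree := by
      refine natDegree_comp_le.trans ?_
      refine (Nat.mul_le_mul_left _ ((natDegree_C_mul_le _ _).trans_eq natDegree_X)).trans_eq
        (mul_one _)
    refine le_trans (Finset.card_le_card fun x hx => ?_)
      ((Multiset.toFinset_card_le g.roots).trans ((card_roots' g).trans hdeg))
    rw [Multiset.mem_toFinset, mem_roots hg0, IsRoot.def, hg, eval_comp, eval_mul, eval_C, eval_X,
      mul_comm, ← Finset.prod_update_of_mem hk]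
    exact (Finset.mem_filter.mp hx).2
  refine (Finset.card_le_card (t := ((Finset.univ : Finset (ι × ι)).filter
    fun p => p.1 ≠ p.2).biUnion Y ∪ 𝒯.biUnion Z) fun a ha => ?_).trans
      ((Finset.card_union_le _ _).trans ?_)
  · rw [Finset.mem_union]
    rcases (Finset.mem_filter.mp ha).2 with h | ⟨T, hT, h⟩
    · left
      simp only [Function.Injective, not_forall] at h
      obtain ⟨i, j, hij, hne⟩ := h
      exact Finset.mem_biUnion.mpr ⟨(i, j), by simp [hne], by simp [Y, hij]⟩
    · right
      exact Finset.mem_biUnion.mpr ⟨T, hT, by simp [Z, h]⟩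
  · rw [add_mul]
    refine add_le_add ((Finset.card_biUnion_le_card_mul _ _ _ hY).trans ?_)
      ((Finset.card_biUnion_le_card_mul _ _ _ hZ).trans_eq ?_)
    · rw [one_mul]
      refine Nat.mul_le_mul_right _ ((Finset.card_filter_le _ _).trans_eq ?_)
      rw [Finset.card_univ, Fintype.card_prod, sq]
    · rw [mul_assoc]

/-- The number of ordered tuples, compared with the expansion of the product of the factors
`1 + χ (f (∏ i ∈ T, a i))`. -/
theorem abs_two_pow_mul_card_sub_le {F ι : Type*} [Field F] [Fintype F] [DecidableEq F]
    [Fintype ι] [DecidableEq ι] {f : F[X]} (hodd : Odd (Fintype.card F)) (hf0 : f.eval 0 ≠ 0)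
    (hf : ¬ ∃ g : (AlgebraicClosure F)[X], f.map (algebraMap F (AlgebraicClosure F)) = g ^ 2)
    {d : ℕ} (hd : 1 ≤ d)
    {𝒯 : Finset (Finset ι)} (h𝒯 : ∀ T ∈ 𝒯, T.card = d)
    [DecidablePred fun a : ι → F => Function.Injective a ∧
      ∀ T ∈ 𝒯, IsSquare (f.eval (∏ i ∈ T, a i))] :
    |2 ^ 𝒯.card * ((Finset.univ.filter fun a : ι → F => Function.Injective a ∧
        ∀ T ∈ 𝒯,
          IsSquare (f.eval (∏ i ∈ T, a i))).card : ℤ) -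
        (Fintype.card F : ℤ) ^ Fintype.card ι| ≤
      2 ^ 𝒯.card * ((Fintype.card F : ℤ) ^ (Fintype.card ι - 1) *
        (((Fintype.card ι ^ 2 + 𝒯.card * f.natDegree) +
        ((22 * (𝒯.card * f.natDegree) + 32) * Nat.sqrt (Fintype.card F)) +
          (Fintype.card ι + 𝒯.card ^ 2 * f.natDegree ^ 2) : ℕ) : ℤ)) := by
  classical
  have hexc := card_not_injective_or_eval_eq_zero_le (ι := ι) hf0 hd h𝒯
  have hchi := fun J hJ hne => abs_sum_quadraticChar_prod_le (ι := ι) (J := J) hodd hf0 hf hd h𝒯 hJ hne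
  set M := 𝒯.card with hM
  set χ := quadraticChar F with hχ
  set A : ℕ := Fintype.card ι ^ 2 + M * f.natDegree with hA
  set K : ℕ := (22 * (M * f.natDegree) + 32) * Nat.sqrt (Fintype.card F) +
    (Fintype.card ι + M ^ 2 * f.natDegree ^ 2) with hK
  set n := Fintype.card ι
  set q := Fintype.card F
  let E : (ι → F) → ℤ := fun a => ∏ T ∈ 𝒯, (1 + χ (f.eval (∏ i ∈ T, a i)))
  have hE : ∑ a, E a = ∑ J ∈ 𝒯.powerset, ∑ a : ι → F, χ (∏ T ∈ J, f.eval (∏ i ∈ T, a i)) := by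
    rw [Finset.sum_comm]
    refine Finset.sum_congr rfl fun a _ => ?_
    simp only [E, Finset.prod_one_add, map_prod]
  have hE1 : |∑ a, E a - (q : ℤ) ^ n| ≤ 2 ^ M * ((q : ℤ) ^ (n - 1) * K) := by
    have hempty : ∑ a : ι → F, χ (∏ T ∈ (∅ : Finset (Finset ι)), f.eval (∏ i ∈ T, a i)) =
        (q : ℤ) ^ n := by
      simp [q, n]
    rw [hE, ← Finset.add_sum_erase _ _ (Finset.empty_mem_powerset 𝒯), hempty, add_sub_cancel_left]
    refine (Finset.abs_sum_le_sum_abs _ _).trans ((Finset.sum_le_card_nsmul _ _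
      ((q : ℤ) ^ (n - 1) * K) fun J hJ => ?_).trans ?_)
    · rw [Finset.mem_erase, Finset.mem_powerset] at hJ
      exact hchi J hJ.2 (Finset.nonempty_iff_ne_empty.mpr hJ.1)
    · rw [nsmul_eq_mul]
      refine mul_le_mul_of_nonneg_right ?_ (by positivity)
      have : (𝒯.powerset.erase ∅).card ≤ 2 ^ M := by
        refine (Finset.card_erase_le).trans_eq ?_
        rw [Finset.card_powerset, hM]
      exact_mod_cast this
  have hfactor : ∀ y : F, 0 ≤ 1 + χ y ∧ 1 + χ y ≤ 2 := by
    intro y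
    have := abs_le.mp (abs_quadraticChar_le_one y)
    constructor <;> linarith
  have hpoint : ∀ a : ι → F,
      |2 ^ M * (if Function.Injective a ∧ ∀ T ∈ 𝒯, IsSquare (f.eval (∏ i ∈ T, a i)) then 1 else 0) -
        E a| ≤ 2 ^ M * (if ¬ Function.Injective a ∨ ∃ T ∈ 𝒯, f.eval (∏ i ∈ T, a i) = 0
          then 1 else 0) := by
    intro a
    by_cases hbad : ¬ Function.Injective a ∨ ∃ T ∈ 𝒯, f.eval (∏ i ∈ T, a i) = 0
    · rw [if_pos hbad]
      have h0 : 0 ≤ E a := Finset.prod_nonneg fun T _ => (hfactor _).1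
      have h1 : E a ≤ 2 ^ M := by
        rw [hM, ← Finset.prod_const]
        exact Finset.prod_le_prod (fun T _ => (hfactor _).1) fun T _ => (hfactor _).2
      rw [abs_le]
      split_ifs <;> constructor <;> linarith
    · rw [if_neg hbad]
      push Not at hbad
      obtain ⟨hinj, hnz⟩ := hbad
      have : 2 ^ M * (if Function.Injective a ∧ ∀ T ∈ 𝒯, IsSquare (f.eval (∏ i ∈ T, a i))
          then 1 else 0) = E a := by
        split_ifs with h
        · rw [mul_one, hM, ← Finset.prod_const]
          refine Finset.prod_congr rfl fun T hT => ?_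
          rw [(quadraticChar_one_iff_isSquare (hnz T hT)).mpr (h.2 T hT)]
          rfl
        · rw [mul_zero]
          simp only [hinj, true_and, not_forall] at h
          obtain ⟨T, hT, hTs⟩ := h
          refine (Finset.prod_eq_zero hT ?_).symm
          rw [quadraticChar_neg_one_iff_not_isSquare.mpr hTs]
          rfl
      rw [this]
      simp
  have hE2 : |2 ^ M * ((Finset.univ.filter fun a : ι → F => Function.Injective a ∧
      ∀ T ∈ 𝒯, IsSquare (f.eval (∏ i ∈ T, a i))).card : ℤ) - ∑ a, E a| ≤
        2 ^ M * ((q : ℤ) ^ (n - 1) * A) := by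
    rw [← Finset.sum_boole, Finset.mul_sum, ← Finset.sum_sub_distrib]
    refine (Finset.abs_sum_le_sum_abs _ _).trans
      ((Finset.sum_le_sum fun a _ => ?_).trans (?_ : ∑ a : ι → F, 2 ^ M *
        (if ¬ Function.Injective a ∨ ∃ T ∈ 𝒯, f.eval (∏ i ∈ T, a i) = 0 then (1 : ℤ) else 0) ≤ _))
    · convert hpoint a
    · rw [← Finset.mul_sum, Finset.sum_boole]
      refine mul_le_mul_of_nonneg_left ?_ (by positivity)
      rw [mul_comm]
      exact_mod_cast hexc
  refine (abs_sub_le _ (∑ a, E a) _).trans ((add_le_add hE2 hE1).trans_eq ?_)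
  rw [hK]
  push_cast
  ring

theorem isSquare_eval_prod_image_iff {F ι : Type*} [Field F] [DecidableEq F] [Fintype ι]
    [DecidableEq ι] (f : F[X]) (d : ℕ) {a : ι → F} (ha : Function.Injective a) :
    (∀ T ⊆ Finset.univ.image a, T.card = d → IsSquare (f.eval (∏ x ∈ T, x))) ↔
      ∀ T ∈ Finset.powersetCard d (Finset.univ : Finset ι), IsSquare (f.eval (∏ i ∈ T, a i)) := by
  constructor
  · intro h T hT
    have := h (T.image a) (Finset.image_subset_image (Finset.subset_univ _))
      (by rw [Finset.card_image_of_injective _ ha, (Finset.mem_powersetCard.mp hT).2])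
    rwa [Finset.prod_image fun x _ y _ hxy => ha hxy] at this
  · intro h T hT hcard
    obtain ⟨U, -, rfl⟩ := Finset.subset_image_iff.mp hT
    rw [Finset.card_image_of_injective _ ha] at hcard
    rw [Finset.prod_image fun x _ y _ hxy => ha hxy]
    exact h U (Finset.mem_powersetCard.mpr ⟨Finset.subset_univ _, hcard⟩)

/-- main theorem, `deg f ≥ 2`: the number of `d`-`f`-Diophantine
`m`-tuples in `F_q` is `q^m/(m!·2^{binom(m,d)}) + O(q^{m-1/2})`, with implied
constant depending only on `deg f`, `m`, `d`. -/
theorem stmt_10 (D m d : ℕ) (hd : 1 ≤ d) (hdm : d < m) (hD : 2 ≤ D) :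
    ∃ C : ℝ, ∀ (F : Type) (_ : Field F) (_ : Fintype F) (_ : DecidableEq F),
      Odd (Fintype.card F) → m ≤ Fintype.card F →
      ∀ f : Polynomial F, f.natDegree = D →
        (¬ ∃ g : Polynomial (AlgebraicClosure F),
          f.map (algebraMap F (AlgebraicClosure F)) = g ^ 2) →
        f.eval 0 ≠ 0 →
        |(Nat.card {S : Finset F // S.card = m ∧
              ∀ T ⊆ S, T.card = d → IsSquare (f.eval (∏ x ∈ T, x))} : ℝ)
            - (Fintype.card F : ℝ) ^ m /
                (Nat.factorial m * 2 ^ Nat.choose m d)|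
          ≤ C * (Fintype.card F : ℝ) ^ (m - 1) * Real.sqrt (Fintype.card F) := by
  classical
  set M := m.choose d with hM
  refine ⟨(m ^ 2 + M * D : ℕ) + (22 * (M * D) + 32 : ℕ) + (m + M ^ 2 * D ^ 2 : ℕ), ?_⟩
  intro F _ _ _ hodd _ f hfD hf hf0
  have key := abs_two_pow_mul_card_sub_le (ι := Fin m) hodd hf0 hf hd
    (𝒯 := Finset.powersetCard d Finset.univ) fun T hT => (Finset.mem_powersetCard.mp hT).2
  have hcount := card_filter_injective_image (F := F) (ι := Fin m)
    (fun S => ∀ T ⊆ S, T.card = d → IsSquare (f.eval (∏ x ∈ T, x)))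
  rw [Finset.filter_congr fun a _ =>
    and_congr_right fun ha => isSquare_eval_prod_image_iff f d ha] at hcount
  rw [Nat.card_eq_fintype_card, Fintype.card_subtype]
  simp only [Fintype.card_fin] at hcount
  rw [hcount, Finset.card_powersetCard, Finset.card_univ, Fintype.card_fin, ← hM, hfD] at key
  set N := (Finset.univ.filter fun S : Finset F => S.card = m ∧
    ∀ T ⊆ S, T.card = d → IsSquare (f.eval (∏ x ∈ T, x))).card
  set q := Fintype.card F
  have hfac : (1 : ℝ) ≤ m.factorial := by
    exact_mod_cast Nat.one_le_iff_ne_zero.mpr m.factorial_ne_zero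
  have h2M : (0 : ℝ) < 2 ^ M := by positivity
  have hq : (1 : ℝ) ≤ q := by exact_mod_cast Fintype.card_pos (α := F)
  have hsqrt1 : 1 ≤ Real.sqrt q := Real.one_le_sqrt.mpr hq
  have hsqrt2 : (Nat.sqrt q : ℝ) ≤ Real.sqrt q := Real.nat_sqrt_le_real_sqrt
  have hkey : |2 ^ M * ((m.factorial : ℝ) * N) - (q : ℝ) ^ m| ≤ 2 ^ M * ((q : ℝ) ^ (m - 1) *
      ((m ^ 2 + M * D : ℕ) + (22 * (M * D) + 32 : ℕ) * (Nat.sqrt q : ℝ) +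
        (m + M ^ 2 * D ^ 2 : ℕ))) := by
    have := (Int.cast_le (R := ℝ)).mpr key
    push_cast at this ⊢
    exact this
  have hdiv : (N : ℝ) - (q : ℝ) ^ m / (m.factorial * 2 ^ M) =
      (2 ^ M * ((m.factorial : ℝ) * N) - (q : ℝ) ^ m) / (m.factorial * 2 ^ M) := by
    field_simp
  rw [hdiv, abs_div, abs_of_pos (show (0 : ℝ) < m.factorial * 2 ^ M by positivity),
    div_le_iff₀ (by positivity)]
  refine hkey.trans ?_
  generalize (m ^ 2 + M * D : ℕ) = c₁
  generalize (22 * (M * D) + 32 : ℕ) = c₂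
  generalize (m + M ^ 2 * D ^ 2 : ℕ) = c₃
  have hbound : (c₁ : ℝ) + c₂ * (Nat.sqrt q : ℝ) + c₃ ≤ (c₁ + c₂ + c₃) * Real.sqrt q := by
    have h1 := mul_le_mul_of_nonneg_left hsqrt1 (Nat.cast_nonneg (α := ℝ) c₁)
    have h2 := mul_le_mul_of_nonneg_left hsqrt2 (Nat.cast_nonneg (α := ℝ) c₂)
    have h3 := mul_le_mul_of_nonneg_left hsqrt1 (Nat.cast_nonneg (α := ℝ) c₃)
    linarith
  calc 2 ^ M * ((q : ℝ) ^ (m - 1) * (c₁ + c₂ * (Nat.sqrt q : ℝ) + c₃))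
      ≤ 2 ^ M * ((q : ℝ) ^ (m - 1) * ((c₁ + c₂ + c₃) * Real.sqrt q)) := by gcongr
    _ ≤ m.factorial * (2 ^ M * ((q : ℝ) ^ (m - 1) * ((c₁ + c₂ + c₃) * Real.sqrt q))) :=
        le_mul_of_one_le_left (by positivity) hfac
    _ = _ := by ring
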